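/- arXiv:math/0703453 — 5 statements merged into one kernel-verified Lean document; each statement's English description precedes it below -/
import Mathlib

section
/- For every x ∈ V with x ≠ (0,0), the function t ↦ H(x,t)/t², regarded on the positive integers t with t ≡ x₁ (mod 2), is unimodal and attains its global maximum at a point t'_max(x) satisfying (x₁²+x₂²)/6 − 1 ≤ t'_max(x) ≤ (x₁²+x₂²)/6 + 2. -/
open Finset

/-- Vertices: we work on `ℤ × ℤ`; the grid `V` consists of points with
`x₁ ≡ x₂ (mod 2)`. -/
abbrev Vtx : Type := ℤ × ℤ

/-- The four diagonal directions. -/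
def DIRset : Finset Vtx := {(1,1), (1,-1), (-1,-1), (-1,1)}

/-- Membership in `V`: both coordinates have the same parity. -/
def inV (x : Vtx) : Prop := x.1 % 2 = x.2 % 2

/-- `H x t`: probability that a random-walk chip starting at `x` is at the
origin after `t` steps. -/
noncomputable def H (x : Vtx) (t : ℕ) : ℝ :=
  if x.1 % 2 = (t : ℤ) % 2 ∧ x.2 % 2 = (t : ℤ) % 2 ∧ |x.1| ≤ (t : ℤ) ∧ |x.2| ≤ (t : ℤ) then
    (4 : ℝ) ^ (-(t : ℤ)) * (Nat.choose t (((t : ℤ) + x.1) / 2).toNat)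
      * (Nat.choose t (((t : ℤ) + x.2) / 2).toNat)
  else 0

/-- `INF x A t := H (x+A) (t-1) - H x t`, for `t ≥ 1`. -/
noncomputable def INF (x A : Vtx) (t : ℕ) : ℝ := H (x + A) (t - 1) - H x t

/-- A function is monotone-or-antitone on a set. -/
def MonoOrAntiOn (g : ℕ → ℝ) (S : Set ℕ) : Prop := MonotoneOn g S ∨ AntitoneOn g S

/-- Unimodal on `X`: monotone up to some `t₁ ∈ X` and monotone from `t₁` on. -/
def UnimodalOn (g : ℕ → ℝ) (X : Set ℕ) : Prop :=
  ∃ t₁ ∈ X, MonoOrAntiOn g (X ∩ Set.Iic t₁) ∧ MonoOrAntiOn g (X ∩ Set.Ici t₁)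

/-- Bimodal on `X`: monotone on `{≤ t₁}`, `[t₁,t₂]` and `{≥ t₂}` for some
`t₁ ≤ t₂` in `X`. -/
def BimodalOn (g : ℕ → ℝ) (X : Set ℕ) : Prop :=
  ∃ t₁ ∈ X, ∃ t₂ ∈ X, t₁ ≤ t₂ ∧ MonoOrAntiOn g (X ∩ Set.Iic t₁) ∧
    MonoOrAntiOn g (X ∩ Set.Icc t₁ t₂) ∧ MonoOrAntiOn g (X ∩ Set.Ici t₂)

/-- Strictly bimodal: bimodal but not unimodal. -/
def StrictlyBimodalOn (g : ℕ → ℝ) (X : Set ℕ) : Prop :=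
  BimodalOn g X ∧ ¬ UnimodalOn g X

/-- The domain of times considered at a vertex `x`: positive integers `t`
with `t ≡ x₁ (mod 2)`. -/
def Xdom (x : Vtx) : Set ℕ := {t : ℕ | 1 ≤ t ∧ (t : ℤ) % 2 = x.1 % 2}

lemma aux_choose (p q : ℕ) :
    ((p + q + 2).choose (p + 1) : ℝ) * (((p : ℝ) + 1) * (q + 1)) =
      ((p + q).choose p : ℝ) * (((p : ℝ) + q + 2) * (p + q + 1)) := by
  have h1 := Nat.add_one_mul_choose_eq (p + q + 1) p
  have h2 := Nat.choose_mul_succ_eq (p + q) p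
  have e : p + q + 1 - p = q + 1 := by omega
  rw [e] at h2
  have h1' : ((p : ℝ) + q + 1 + 1) * ((p + q + 1).choose p : ℝ) =
      ((p + q + 2).choose (p + 1) : ℝ) * (p + 1) := by exact_mod_cast h1
  have h2' : ((p + q).choose p : ℝ) * ((p : ℝ) + q + 1) =
      ((p + q + 1).choose p : ℝ) * (q + 1) := by exact_mod_cast h2
  linear_combination (-((q : ℝ) + 1)) * h1' - ((p : ℝ) + q + 2) * h2'

lemma aux_choose' (t : ℕ) (a : ℤ) (hp : a % 2 = (t : ℤ) % 2) (ha : |a| ≤ (t : ℤ)) :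
    ((t + 2).choose ((((t + 2 : ℕ) : ℤ) + a) / 2).toNat : ℝ) * (((t : ℝ) + 2) ^ 2 - (a : ℝ) ^ 2) =
      4 * ((t.choose (((t : ℤ) + a) / 2).toNat : ℝ) * (((t : ℝ) + 2) * (t + 1))) := by
  rw [abs_le] at ha
  obtain ⟨p, hp'⟩ : ∃ p : ℕ, (p : ℤ) = (t + a) / 2 := ⟨((t + a) / 2).toNat, by omega⟩
  obtain ⟨q, hq'⟩ : ∃ q : ℕ, (q : ℤ) = (t - a) / 2 := ⟨((t - a) / 2).toNat, by omega⟩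
  have ht : t = p + q := by omega
  have haa : a = (p : ℤ) - q := by omega
  have e1 : ((((t + 2 : ℕ) : ℤ) + a) / 2).toNat = p + 1 := by omega
  have e2 : (((t : ℤ) + a) / 2).toNat = p := by omega
  rw [e1, e2]
  subst ht haa
  have := aux_choose p q
  push_cast
  linear_combination 4 * this

lemma H_nonneg (x : Vtx) (t : ℕ) : 0 ≤ H x t := by
  unfold H; split_ifs <;> positivity

lemma H_step (x : Vtx) (t : ℕ) (h1 : x.1 % 2 = (t : ℤ) % 2) (h2 : x.2 % 2 = (t : ℤ) % 2)
    (h3 : |x.1| ≤ (t : ℤ)) (h4 : |x.2| ≤ (t : ℤ)) :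
    H x (t + 2) * ((((t : ℝ) + 2) ^ 2 - (x.1 : ℝ) ^ 2) * (((t : ℝ) + 2) ^ 2 - (x.2 : ℝ) ^ 2)) =
      H x t * (((t : ℝ) + 1) ^ 2 * (t + 2) ^ 2) := by
  unfold H
  rw [if_pos ⟨by push_cast; omega, by push_cast; omega, by push_cast; omega, by push_cast; omega⟩,
    if_pos ⟨h1, h2, h3, h4⟩]
  have c1 := aux_choose' t x.1 h1 h3
  have c2 := aux_choose' t x.2 h2 h4
  have e : (4 : ℝ) ^ (-(t : ℤ)) = 16 * (4 : ℝ) ^ (-((t + 2 : ℕ) : ℤ)) := by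
    rw [zpow_neg, zpow_neg, zpow_natCast, zpow_natCast, pow_add]; field_simp; norm_num
  rw [e]
  generalize (4 : ℝ) ^ (-((t + 2 : ℕ) : ℤ)) = z
  generalize ((t + 2).choose ((((t + 2 : ℕ) : ℤ) + x.1) / 2).toNat : ℝ) = C1 at *
  generalize ((t + 2).choose ((((t + 2 : ℕ) : ℤ) + x.2) / 2).toNat : ℝ) = C2 at *
  calc _ = z * (C1 * (((t : ℝ) + 2) ^ 2 - (x.1 : ℝ) ^ 2)) *
        (C2 * (((t : ℝ) + 2) ^ 2 - (x.2 : ℝ) ^ 2)) := by ring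
    _ = _ := by rw [c1, c2]; ring

lemma alg_down (t a b : ℤ) (ht : 1 ≤ t) (h : a ^ 2 + b ^ 2 + 13 ≤ 6 * (t + 2)) :
    t ^ 2 * (t + 1) ^ 2 ≤ ((t + 2) ^ 2 - a ^ 2) * ((t + 2) ^ 2 - b ^ 2) := by
  have h1 : 0 ≤ (t + 2) ^ 2 * (6 * (t + 2) - 13 - (a ^ 2 + b ^ 2)) :=
    mul_nonneg (by positivity) (by linarith)
  have h2 : 0 ≤ a ^ 2 * b ^ 2 := by positivity
  nlinarith

lemma alg_up (t a b : ℤ) (ht : 1 ≤ t) (ha : |a| ≤ t) (hb : |b| ≤ t)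
    (h : 6 * (t + 2) ≤ a ^ 2 + b ^ 2 + 4) :
    ((t + 2) ^ 2 - a ^ 2) * ((t + 2) ^ 2 - b ^ 2) ≤ t ^ 2 * (t + 1) ^ 2 := by
  have hA : a ^ 2 ≤ t ^ 2 := sq_le_sq' (abs_le.mp ha).1 (abs_le.mp ha).2
  have hB : b ^ 2 ≤ t ^ 2 := sq_le_sq' (abs_le.mp hb).1 (abs_le.mp hb).2
  generalize a ^ 2 = A at *
  generalize b ^ 2 = B at *
  have h1 : 0 ≤ (A + B + 4 - 6 * (t + 2)) *
      (4 * (t + 2) ^ 2 - 12 * (t + 2) + (6 * (t + 2) - (A + B)) + 4) :=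
    mul_nonneg (by linarith) (by nlinarith)
  have h2 : 0 ≤ (A - B) ^ 2 := sq_nonneg _
  nlinarith

lemma P_pos (x : Vtx) (t : ℕ) (h3 : |x.1| ≤ (t : ℤ)) (h4 : |x.2| ≤ (t : ℤ)) :
    0 < (((t : ℝ) + 2) ^ 2 - (x.1 : ℝ) ^ 2) * (((t : ℝ) + 2) ^ 2 - (x.2 : ℝ) ^ 2) := by
  have key : ∀ a : ℤ, |a| ≤ (t : ℤ) → 0 < ((t : ℝ) + 2) ^ 2 - (a : ℝ) ^ 2 := by
    intro a ha
    have hA : a ^ 2 ≤ (t : ℤ) ^ 2 := sq_le_sq' (abs_le.mp ha).1 (abs_le.mp ha).2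
    have : (a : ℝ) ^ 2 ≤ (t : ℝ) ^ 2 := by exact_mod_cast hA
    have : (0 : ℝ) ≤ t := by positivity
    nlinarith
  exact mul_pos (key _ h3) (key _ h4)

lemma g_down (x : Vtx) (t : ℕ) (ht : 1 ≤ t) (h1 : x.1 % 2 = (t : ℤ) % 2)
    (h2 : x.2 % 2 = (t : ℤ) % 2)
    (h3 : |x.1| ≤ (t : ℤ)) (h4 : |x.2| ≤ (t : ℤ)) (h : x.1 ^ 2 + x.2 ^ 2 + 13 ≤ 6 * ((t : ℤ) + 2)) :
    H x (t + 2) / ((t + 2 : ℕ) : ℝ) ^ 2 ≤ H x t / (t : ℝ) ^ 2 := by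
  have hs := H_step x t h1 h2 h3 h4
  have hP := P_pos x t h3 h4
  have ha : (t : ℝ) ^ 2 * (t + 1) ^ 2 ≤
      (((t : ℝ) + 2) ^ 2 - (x.1 : ℝ) ^ 2) * (((t : ℝ) + 2) ^ 2 - (x.2 : ℝ) ^ 2) := by
    exact_mod_cast alg_down t x.1 x.2 (by exact_mod_cast ht) h
  have ht' : (0 : ℝ) < t := by exact_mod_cast ht
  generalize (((t : ℝ) + 2) ^ 2 - (x.1 : ℝ) ^ 2) * (((t : ℝ) + 2) ^ 2 - (x.2 : ℝ) ^ 2) = P at *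
  have hn := H_nonneg x t
  push_cast
  rw [div_le_div_iff₀ (by positivity) (by positivity)]
  refine le_of_mul_le_mul_right ?_ hP
  have : 0 ≤ H x t * (t + 2 : ℝ) ^ 2 := by positivity
  calc _ = (H x (t + 2) * P) * t ^ 2 := by ring
    _ = (H x t * (t + 2 : ℝ) ^ 2) * (t ^ 2 * (t + 1) ^ 2) := by rw [hs]; ring
    _ ≤ _ := mul_le_mul_of_nonneg_left ha this

lemma g_up (x : Vtx) (t : ℕ) (ht : 1 ≤ t) (h1 : x.1 % 2 = (t : ℤ) % 2)
    (h2 : x.2 % 2 = (t : ℤ) % 2)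
    (h : 6 * ((t : ℤ) + 2) ≤ x.1 ^ 2 + x.2 ^ 2 + 4) :
    H x t / (t : ℝ) ^ 2 ≤ H x (t + 2) / ((t + 2 : ℕ) : ℝ) ^ 2 := by
  by_cases hh : |x.1| ≤ (t : ℤ) ∧ |x.2| ≤ (t : ℤ)
  swap
  · have : H x t = 0 := by
      unfold H; rw [if_neg]; rintro ⟨_, _, h⟩; exact hh h
    rw [this, zero_div]
    have := H_nonneg x (t + 2)
    positivity
  obtain ⟨h3, h4⟩ := hh
  have hs := H_step x t h1 h2 h3 h4
  have hP := P_pos x t h3 h4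
  have ha : 
      (((t : ℝ) + 2) ^ 2 - (x.1 : ℝ) ^ 2) * (((t : ℝ) + 2) ^ 2 - (x.2 : ℝ) ^ 2) ≤
        (t : ℝ) ^ 2 * (t + 1) ^ 2 := by
    exact_mod_cast alg_up t x.1 x.2 (by exact_mod_cast ht) h3 h4 h
  have ht' : (0 : ℝ) < t := by exact_mod_cast ht
  generalize (((t : ℝ) + 2) ^ 2 - (x.1 : ℝ) ^ 2) * (((t : ℝ) + 2) ^ 2 - (x.2 : ℝ) ^ 2) = P at *
  have hn := H_nonneg x t
  push_cast
  rw [div_le_div_iff₀ (by positivity) (by positivity)]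
  refine le_of_mul_le_mul_right ?_ hP
  have : 0 ≤ H x t * (t + 2 : ℝ) ^ 2 := by positivity
  calc _ ≤ (H x t * (t + 2 : ℝ) ^ 2) * (t ^ 2 * (t + 1) ^ 2) := mul_le_mul_of_nonneg_left ha this
    _ = (H x (t + 2) * P) * t ^ 2 := by rw [hs]; ring
    _ = _ := by ring

lemma exists_peak (x : Vtx) (hx : inV x) (hx0 : x ≠ (0, 0)) :
    ∃ tm ∈ Xdom x,
      (∀ t ∈ Xdom x, t + 2 ≤ tm →
        H x t / (t : ℝ) ^ 2 ≤ H x (t + 2) / ((t + 2 : ℕ) : ℝ) ^ 2) ∧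
      (∀ t ∈ Xdom x, tm ≤ t →
        H x (t + 2) / ((t + 2 : ℕ) : ℝ) ^ 2 ≤ H x t / (t : ℝ) ^ 2) ∧
      x.1 ^ 2 + x.2 ^ 2 ≤ 6 * (tm : ℤ) + 6 ∧ 6 * (tm : ℤ) ≤ x.1 ^ 2 + x.2 ^ 2 + 12 := by
  unfold inV at hx
  obtain ⟨m, hm⟩ : ∃ m : ℕ, (m : ℤ) = max |x.1| |x.2| :=
    ⟨(max |x.1| |x.2|).toNat, by have := abs_nonneg x.1; omega⟩
  have hm1 : 1 ≤ m := by
    by_contra hc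
    apply hx0
    have a1 := abs_nonneg x.1
    have a2 := abs_nonneg x.2
    have b1 : |x.1| = 0 := by omega
    have b2 : |x.2| = 0 := by omega
    ext
    · simpa using b1
    · simpa using b2
  have hmp : (m : ℤ) % 2 = x.1 % 2 := by
    rcases abs_choice x.1 with h | h <;> rcases abs_choice x.2 with h' | h' <;> omega
  have hmS : (m : ℤ) ^ 2 ≤ x.1 ^ 2 + x.2 ^ 2 := by
    rcases max_choice |x.1| |x.2| with h | h <;> rw [hm, h, sq_abs] <;> nlinarith [sq_nonneg x.1, sq_nonneg x.2]
  have hm6 : 6 * (m : ℤ) ≤ x.1 ^ 2 + x.2 ^ 2 + 12 := by nlinarith [sq_nonneg ((m : ℤ) - 3)]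
  have hev : (x.1 ^ 2 + x.2 ^ 2) % 2 = 0 := by
    rcases Int.emod_two_eq_zero_or_one x.1 with h | h <;>
      (have h' := hx.symm.trans h; simp [pow_two, Int.add_emod, Int.mul_emod, h, h'])
  have h3m : |x.1| ≤ (m : ℤ) := by omega
  have h4m : |x.2| ≤ (m : ℤ) := by omega
  have hup : ∀ t ∈ Xdom x, 6 * ((t : ℤ) + 2) ≤ x.1 ^ 2 + x.2 ^ 2 + 4 →
      H x t / (t : ℝ) ^ 2 ≤ H x (t + 2) / ((t + 2 : ℕ) : ℝ) ^ 2 := fun t ht h =>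
    g_up x t ht.1 ht.2.symm (hx.symm.trans ht.2.symm) h
  have hlow : ∀ t ∈ Xdom x, t + 2 ≤ m →
      H x t / (t : ℝ) ^ 2 ≤ H x (t + 2) / ((t + 2 : ℕ) : ℝ) ^ 2 := by
    intro t ht h
    have : H x t = 0 := by
      unfold H; rw [if_neg]; rintro ⟨_, _, h⟩; omega
    rw [this, zero_div]
    have := H_nonneg x (t + 2)
    positivity
  have hdn : ∀ t ∈ Xdom x, m ≤ t → x.1 ^ 2 + x.2 ^ 2 + 13 ≤ 6 * ((t : ℤ) + 2) →
      H x (t + 2) / ((t + 2 : ℕ) : ℝ) ^ 2 ≤ H x t / (t : ℝ) ^ 2 := fun t ht hmt h =>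
    g_down x t ht.1 ht.2.symm (hx.symm.trans ht.2.symm) (by omega) (by omega) h
  have hS0 : 0 ≤ x.1 ^ 2 + x.2 ^ 2 := by positivity
  generalize x.1 ^ 2 + x.2 ^ 2 = S at *
  obtain ⟨u, hu1, hu2, hu3⟩ : ∃ u : ℕ, (u : ℤ) % 2 = x.1 % 2 ∧ S + 6 ≤ 6 * u ∧ 6 * (u : ℤ) < S + 18 := by
    refine ⟨(x.1 % 2 + 2 * ((S + 17 - 6 * (x.1 % 2)) / 12)).toNat, ?_, ?_, ?_⟩ <;> omega
  by_cases hum : u < m + 2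
  · refine ⟨m, ⟨hm1, hmp⟩, hlow, ?_, by omega, hm6⟩
    intro t ht hmt
    have := ht.2
    exact hdn t ht hmt (by omega)
  obtain ⟨v, rfl⟩ : ∃ v, u = v + 2 := ⟨u - 2, by omega⟩
  have hv : v ∈ Xdom x := ⟨by omega, by push_cast at hu1; omega⟩
  by_cases hc : H x (v + 2) / ((v + 2 : ℕ) : ℝ) ^ 2 ≤ H x v / (v : ℝ) ^ 2
  · refine ⟨v, hv, ?_, ?_, by omega, by omega⟩
    · intro t ht h
      have := ht.2
      exact hup t ht (by omega)
    · intro t ht h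
      have := ht.2
      rcases h.eq_or_lt with rfl | h
      · exact hc
      · exact hdn t ht (by omega) (by omega)
  · refine ⟨v + 2, ⟨by omega, hu1⟩, ?_, ?_, by omega, ?_⟩
    · intro t ht h
      have := ht.2
      by_cases htv : t = v
      · subst htv; exact (not_le.mp hc).le
      · exact hup t ht (by omega)
    · intro t ht h
      have := ht.2
      exact hdn t ht (by omega) (by omega)
    · by_contra hcon
      exact hc (hdn v hv (by omega) (by omega))

lemma mono_of_steps (x : Vtx) (g : ℕ → ℝ) (tm : ℕ)
    (h : ∀ t ∈ Xdom x, t + 2 ≤ tm → g t ≤ g (t + 2)) :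
    MonotoneOn g (Xdom x ∩ Set.Iic tm) := by
  have key : ∀ k t : ℕ, t ∈ Xdom x → t + 2 * k ≤ tm → g t ≤ g (t + 2 * k) := by
    intro k
    induction k with
    | zero => intro t _ _; simp
    | succ k ih =>
      intro t ht hk
      refine (ih t ht (by omega)).trans ?_
      have h1 := ht.1
      have h2 := ht.2
      exact h (t + 2 * k) ⟨by omega, by push_cast; omega⟩ (by omega)
  rintro a ⟨ha, _⟩ b ⟨hb, hb'⟩ hab
  have h2 := ha.2
  have h3 := hb.2
  obtain ⟨k, rfl⟩ : ∃ k, b = a + 2 * k := ⟨(b - a) / 2, by omega⟩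
  exact key k a ha hb'

lemma anti_of_steps (x : Vtx) (g : ℕ → ℝ) (tm : ℕ)
    (h : ∀ t ∈ Xdom x, tm ≤ t → g (t + 2) ≤ g t) :
    AntitoneOn g (Xdom x ∩ Set.Ici tm) := by
  have key : ∀ k t : ℕ, t ∈ Xdom x → tm ≤ t → g (t + 2 * k) ≤ g t := by
    intro k
    induction k with
    | zero => intro t _ _; simp
    | succ k ih =>
      intro t ht hk
      refine le_trans ?_ (ih t ht (by omega))
      have h1 := ht.1
      have h2 := ht.2
      exact h (t + 2 * k) ⟨by omega, by push_cast; omega⟩ (by omega)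
  rintro a ⟨ha, ha'⟩ b ⟨hb, _⟩ hab
  have h2 := ha.2
  have h3 := hb.2
  obtain ⟨k, rfl⟩ : ∃ k, b = a + 2 * k := ⟨(b - a) / 2, by omega⟩
  exact key k a ha ha'

/-- For `x ∈ V`, `x ≠ 0`, the function `t ↦ H(x,t)/t²` is unimodal on the
positive integers `t ≡ x₁ (mod 2)`, with global maximum attained at some
`t'_max` with `(x₁²+x₂²)/6 − 1 ≤ t'_max ≤ (x₁²+x₂²)/6 + 2`. -/
theorem H_div_t_sq_unimodal (x : Vtx) (hx : inV x) (hx0 : x ≠ (0, 0)) :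
    UnimodalOn (fun t => H x t / (t : ℝ)^2) (Xdom x) ∧
    ∃ tm ∈ Xdom x, (∀ t ∈ Xdom x, H x t / (t : ℝ)^2 ≤ H x tm / (tm : ℝ)^2) ∧
      ((x.1 : ℝ)^2 + (x.2 : ℝ)^2) / 6 - 1 ≤ (tm : ℝ) ∧
      (tm : ℝ) ≤ ((x.1 : ℝ)^2 + (x.2 : ℝ)^2) / 6 + 2 := by
  obtain ⟨tm, htm, hu, hd, hb1, hb2⟩ := exists_peak x hx hx0
  have hm := mono_of_steps x (fun t => H x t / (t : ℝ) ^ 2) tm hu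
  have ha := anti_of_steps x (fun t => H x t / (t : ℝ) ^ 2) tm hd
  refine ⟨⟨tm, htm, Or.inl hm, Or.inr ha⟩, tm, htm, ?_, ?_, ?_⟩
  · intro t ht
    rcases le_total t tm with h | h
    · exact hm ⟨ht, h⟩ ⟨htm, le_refl tm⟩ h
    · exact ha ⟨htm, le_refl tm⟩ ⟨ht, h⟩ h
  · have : (x.1 : ℝ) ^ 2 + (x.2 : ℝ) ^ 2 ≤ 6 * (tm : ℝ) + 6 := by exact_mod_cast hb1
    linarith
  · have : 6 * (tm : ℝ) ≤ (x.1 : ℝ) ^ 2 + (x.2 : ℝ) ^ 2 + 12 := by exact_mod_cast hb2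
    linarith
end

section
/- For every x ∈ ℤ² with x₁ ≡ x₂ (mod 2), every A = (A₁,A₂) ∈ DIR, and every integer t ≥ 1, one has the exact identity INF(x,A,t) = ( (A₁x₁ · A₂x₂)/t² − (A₁x₁ + A₂x₂)/t ) · H(x,t). -/
open Finset

/-- One-dimensional factor of `H`. -/
noncomputable def h1d (a : ℤ) (t : ℕ) : ℝ :=
  if a % 2 = (t : ℤ) % 2 ∧ |a| ≤ (t : ℤ) then
    ((2 : ℝ) ^ t)⁻¹ * (Nat.choose t (((t : ℤ) + a) / 2).toNat)
  else 0

theorem H_eq_mul (x : Vtx) (t : ℕ) : H x t = h1d x.1 t * h1d x.2 t := by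
  unfold H h1d
  have h4 : (4 : ℝ) ^ (-(t : ℤ)) = ((2 : ℝ) ^ t)⁻¹ * ((2 : ℝ) ^ t)⁻¹ := by
    rw [zpow_neg, zpow_natCast, ← mul_inv, ← mul_pow]; norm_num
  by_cases c1 : x.1 % 2 = (t : ℤ) % 2 ∧ |x.1| ≤ (t : ℤ)
  · by_cases c2 : x.2 % 2 = (t : ℤ) % 2 ∧ |x.2| ≤ (t : ℤ)
    · rw [if_pos c1, if_pos c2, if_pos ⟨c1.1, c2.1, c1.2, c2.2⟩, h4]; ring
    · rw [if_neg c2, if_neg (fun h => c2 ⟨h.2.1, h.2.2.2⟩), mul_zero]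
  · rw [if_neg c1, if_neg (fun h => c1 ⟨h.1, h.2.2.1⟩), zero_mul]

theorem h1d_pos (k m : ℕ) (a : ℤ) (t : ℕ) (ht : t = k + m) (ha : a = (k : ℤ) - m) :
    h1d a t = ((2 : ℝ) ^ t)⁻¹ * (Nat.choose t k) := by
  unfold h1d
  have e : (((t : ℤ) + a) / 2).toNat = k := by omega
  rw [if_pos ⟨by omega, by rw [abs_le]; omega⟩, e]

theorem h1d_step (a s : ℤ) (hs : s = 1 ∨ s = -1) (n : ℕ) :
    h1d (a + s) n * ((n : ℝ) + 1) = ((n : ℝ) + 1 - s * a) * h1d a (n + 1) := by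
  by_cases c : a % 2 = ((n + 1 : ℕ) : ℤ) % 2 ∧ |a| ≤ ((n + 1 : ℕ) : ℤ)
  · obtain ⟨c1, c2⟩ := c
    rw [abs_le] at c2
    obtain ⟨k, m, hk, hm⟩ : ∃ k m : ℕ, n + 1 = k + m ∧ a = (k : ℤ) - m :=
      ⟨(((n + 1 : ℕ) + a) / 2).toNat, (((n + 1 : ℕ) - a) / 2).toNat, by omega, by omega⟩
    rw [h1d_pos k m a (n + 1) hk hm]
    have hkR : (n : ℝ) + 1 = k + m := by exact_mod_cast hk
    have haR : (a : ℝ) = k - m := by rw [hm]; push_cast; ring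
    rcases hs with rfl | rfl
    · rcases m with _ | m
      · have : h1d (a + 1) n = 0 := by
          unfold h1d
          rw [if_neg]
          rw [abs_le]; omega
        rw [this, haR, hkR]; push_cast; ring
      · rw [h1d_pos k m (a + 1) n (by omega) (by omega)]
        have := Nat.choose_mul_succ_eq n k
        rw [show n + 1 - k = m + 1 by omega] at this
        have hR : (n.choose k : ℝ) * (n + 1) = (n + 1).choose k * (m + 1) := by
          exact_mod_cast this
        rw [mul_assoc, hR, haR, hkR, pow_succ]
        push_cast
        field_simp
        ring
    · rcases k with _ | k
      · have : h1d (a + -1) n = 0 := by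
          unfold h1d
          rw [if_neg]
          rw [abs_le]; omega
        rw [this, haR, hkR]; push_cast; ring
      · rw [h1d_pos k m (a + -1) n (by omega) (by omega)]
        have := Nat.add_one_mul_choose_eq n k
        have hR : (n.choose k : ℝ) * (n + 1) = (n + 1).choose (k + 1) * (k + 1) := by
          rw [mul_comm]; exact_mod_cast this
        rw [mul_assoc, hR, haR, hkR, pow_succ]
        push_cast
        field_simp
        ring
  · have e1 : h1d a (n + 1) = 0 := by unfold h1d; rw [if_neg c]
    have e2 : h1d (a + s) n = 0 := by
      unfold h1d
      rw [if_neg]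
      rw [abs_le] at c ⊢
      rcases hs with rfl | rfl <;> omega
    rw [e1, e2]; ring

/-- Exact identity:
`INF(x,A,t) = ((A₁x₁·A₂x₂)/t² − (A₁x₁ + A₂x₂)/t) · H(x,t)`. -/
theorem INF_eq_formula (x : Vtx) (hx : inV x) (A : Vtx) (hA : A ∈ DIRset)
    (t : ℕ) (ht : 1 ≤ t) :
    INF x A t = ((((A.1 * x.1) * (A.2 * x.2) : ℤ) : ℝ) / (t : ℝ)^2
      - (((A.1 * x.1 + A.2 * x.2 : ℤ)) : ℝ) / (t : ℝ)) * H x t := by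
  have hs : (A.1 = 1 ∨ A.1 = -1) ∧ (A.2 = 1 ∨ A.2 = -1) := by
    simp only [DIRset, Finset.mem_insert, Finset.mem_singleton] at hA
    rcases hA with rfl | rfl | rfl | rfl <;> simp
  obtain ⟨n, rfl⟩ : ∃ n, t = n + 1 := ⟨t - 1, by omega⟩
  have e1 := h1d_step x.1 A.1 hs.1 n
  have e2 := h1d_step x.2 A.2 hs.2 n
  have hn : (n : ℝ) + 1 ≠ 0 := by positivity
  rw [← eq_div_iff hn] at e1 e2
  unfold INF
  rw [H_eq_mul, H_eq_mul, Nat.add_sub_cancel, Prod.fst_add, Prod.snd_add, e1, e2]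
  push_cast
  field_simp
  ring
end

section
/- For every x ∈ ℤ² with x₁ ≡ x₂ (mod 2) and ‖x‖_∞ ≥ 88, and every integer t ≥ 1, one has H(x,t)/t ≤ 17/(x₁² + x₂²)². -/
open Finset

theorem cb_bound (m : ℕ) : (m.centralBinom : ℝ)^2 * (2*m+1) ≤ 16^m := by
  induction m with
  | zero => simp
  | succ n ih =>
    have h := Nat.succ_mul_centralBinom_succ n
    have h' : ((n:ℝ)+1) * ((n+1).centralBinom : ℝ) = 2 * (2*n+1) * (n.centralBinom : ℝ) := by
      exact_mod_cast h
    have hn : (0:ℝ) ≤ n := Nat.cast_nonneg n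
    have hp : (0:ℝ) < ((n:ℝ)+1)^2 := by positivity
    refine le_of_mul_le_mul_left ?_ hp
    have e : ((n:ℝ)+1)^2 * (((n+1).centralBinom : ℝ)^2 * (2*((n+1:ℕ):ℝ)+1))
        = 4 * (2*n+1)*(2*n+3) * ((n.centralBinom : ℝ)^2 * (2*n+1)) := by
      push_cast
      calc _ = (((n:ℝ)+1) * ((n+1).centralBinom : ℝ))^2 * (2*(n+1)+1) := by ring
        _ = _ := by rw [h']; ring
    rw [e]
    calc 4 * (2*(n:ℝ)+1)*(2*n+3) * ((n.centralBinom : ℝ)^2 * (2*n+1))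
        ≤ 4 * (2*(n:ℝ)+1)*(2*n+3) * 16^n := by gcongr
      _ ≤ (16 * ((n:ℝ)+1)^2) * 16^n := by
          apply mul_le_mul_of_nonneg_right _ (by positivity)
          nlinarith
      _ = _ := by ring

theorem base_bound (t : ℕ) (ht : 1 ≤ t) :
    (t.choose ((t+1)/2) : ℝ)^2 * t ≤
      4^t * Real.exp (-((2*(((t+1)/2 : ℕ):ℝ) - t)^2/(2*t))) := by
  rcases Nat.even_or_odd' t with ⟨m, rfl | rfl⟩
  · have e : (2*m+1)/2 = m := by omega
    rw [e]
    have h := cb_bound m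
    rw [Nat.centralBinom] at h
    have e2 : (4:ℝ)^(2*m) = 16^m := by rw [pow_mul]; norm_num
    rw [e2]
    push_cast
    simp only [sub_self, ne_eq, OfNat.ofNat_ne_zero, not_false_eq_true, zero_pow, zero_div,
      neg_zero, Real.exp_zero, mul_one]
    nlinarith [sq_nonneg (((2*m).choose m : ℕ) : ℝ)]
  · have e : (2*m+1+1)/2 = m+1 := by omega
    rw [e]
    have h := cb_bound (m+1)
    have hc : (m+1).centralBinom = 2 * (2*m+1).choose (m+1) := by
      rw [Nat.centralBinom, show 2*(m+1) = (2*m+1)+1 by ring, Nat.choose_succ_succ,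
        Nat.choose_symm_half]
      ring
    rw [hc] at h
    push_cast at h ⊢
    have e2 : (4:ℝ)^(2*m+1) = 4 * 16^m := by rw [pow_succ, pow_mul]; norm_num; ring
    rw [e2]
    have e3 : (2*((m:ℝ)+1) - (2*m+1))^2 = 1 := by ring
    rw [e3]
    set C : ℝ := (((2*m+1).choose (m+1) : ℕ) : ℝ)
    have hm : (0:ℝ) ≤ m := Nat.cast_nonneg m
    have hexp : 1 - 1/(2*(2*(m:ℝ)+1)) ≤ Real.exp (-(1/(2*(2*(m:ℝ)+1)))) := by
      have := Real.add_one_le_exp (-(1/(2*(2*(m:ℝ)+1))))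
      linarith
    have h2 : C^2 * (2*m+3) ≤ 4*16^m := by rw [pow_succ (16:ℝ)] at h; nlinarith
    have h3 : (2*(m:ℝ)+1) ≤ (2*m+3) * (1 - 1/(2*(2*(m:ℝ)+1))) := by
      have : (2*(m:ℝ)+3) * (1 - 1/(2*(2*(m:ℝ)+1))) - (2*m+1) = (6*m+1)/(2*(2*(m:ℝ)+1)) := by
        field_simp; ring
      have h4 : 0 ≤ (6*(m:ℝ)+1)/(2*(2*(m:ℝ)+1)) := by positivity
      linarith
    calc C^2 * (2*m+1) ≤ C^2 * ((2*m+3) * Real.exp (-(1/(2*(2*(m:ℝ)+1))))) := by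
          apply mul_le_mul_of_nonneg_left _ (sq_nonneg _)
          exact h3.trans (mul_le_mul_of_nonneg_left hexp (by positivity))
      _ = (C^2 * (2*m+3)) * Real.exp (-(1/(2*(2*(m:ℝ)+1)))) := by ring
      _ ≤ _ := mul_le_mul_of_nonneg_right h2 (Real.exp_nonneg _)

theorem half_bound (t : ℕ) (ht : 1 ≤ t) (k : ℕ) (hk : (t+1)/2 ≤ k) :
    (t.choose k : ℝ)^2 * t ≤ 4^t * Real.exp (-((2*(k:ℝ) - t)^2/(2*t))) := by
  induction k, hk using Nat.le_induction with
  | base => exact base_bound t ht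
  | succ k hk ih =>
    rcases Nat.lt_or_ge t (k+1) with hlt | hge
    · rw [Nat.choose_eq_zero_of_lt hlt]
      simp only [Nat.cast_zero, ne_eq, OfNat.ofNat_ne_zero, not_false_eq_true, zero_pow, zero_mul]
      positivity
    have h := Nat.choose_succ_right_eq t k
    have h' : (t.choose (k+1) : ℝ) * (k+1) = t.choose k * ((t:ℝ) - k) := by
      rw [← Nat.cast_sub (by omega : k ≤ t)]; exact_mod_cast h
    have ht0 : (0:ℝ) < t := by exact_mod_cast ht
    have hk1 : (0:ℝ) < (k:ℝ)+1 := by positivity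
    have hkt : (k:ℝ)+1 ≤ t := by exact_mod_cast hge
    have h2k : (t:ℝ) ≤ 2*k := by
      have : t ≤ 2*k := by omega
      exact_mod_cast this
    set q : ℝ := ((t:ℝ)-k)/(k+1) with hq
    have hq0 : 0 ≤ q := div_nonneg (by linarith) hk1.le
    have hc : (t.choose (k+1) : ℝ) = t.choose k * q := by
      rw [hq]; field_simp; linarith
    have hqe : q ≤ Real.exp (-((2*(k:ℝ)-t+1)/t)) := by
      have h1 := Real.add_one_le_exp (-((2*(k:ℝ)-t+1)/t))
      refine le_trans ?_ h1
      rw [hq, div_le_iff₀ hk1]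
      have : (-((2*(k:ℝ)-t+1)/t) + 1) * (k+1) = ((2*t-2*k-1)*(k+1))/t := by field_simp; ring
      rw [this, le_div_iff₀ ht0]
      nlinarith [mul_nonneg (by linarith : (0:ℝ) ≤ 2*k-t+1) (by linarith : (0:ℝ) ≤ t-k-1)]
    have hqe2 : q^2 ≤ Real.exp (-((2*(k:ℝ)-t+1)/t))^2 := by gcongr
    calc (t.choose (k+1) : ℝ)^2 * t = ((t.choose k : ℝ)^2 * t) * q^2 := by rw [hc]; ring
      _ ≤ (4^t * Real.exp (-((2*(k:ℝ) - t)^2/(2*t)))) * Real.exp (-((2*(k:ℝ)-t+1)/t))^2 := by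
          gcongr
      _ = _ := by
          rw [← Real.exp_nat_mul, mul_assoc, ← Real.exp_add]
          congr 2
          push_cast
          field_simp
          ring

theorem int_bound (t : ℕ) (ht : 1 ≤ t) (a : ℤ) (hp : a % 2 = (t:ℤ) % 2) (ha : |a| ≤ t) :
    (t.choose (((t:ℤ)+a)/2).toNat : ℝ)^2 * t ≤ 4^t * Real.exp (-((a:ℝ)^2/(2*t))) := by
  rw [abs_le] at ha
  obtain ⟨k, hk⟩ : ∃ k : ℕ, (((t:ℤ)+a)/2).toNat = k := ⟨_, rfl⟩
  have hka : (a:ℤ) = 2*k - t := by omega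
  have hkt : k ≤ t := by omega
  rw [hk]
  have har : (a:ℝ) = 2*k - t := by exact_mod_cast hka
  rw [har]
  by_cases h : (t+1)/2 ≤ k
  · exact half_bound t ht k h
  · have h1 := half_bound t ht (t-k) (by omega)
    rw [Nat.choose_symm hkt, Nat.cast_sub hkt] at h1
    convert h1 using 5
    ring

/-- For `‖x‖_∞ ≥ 88` and all `t ≥ 1`: `H(x,t)/t ≤ 17/(x₁²+x₂²)²`. -/
theorem H_div_t_le (x : Vtx) (hx : inV x) (hbig : 88 ≤ max |x.1| |x.2|)
    (t : ℕ) (ht : 1 ≤ t) :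
    H x t / (t : ℝ) ≤ 17 / ((x.1 : ℝ)^2 + (x.2 : ℝ)^2)^2 := by
  unfold H
  split_ifs with hc
  swap
  · rw [zero_div]; positivity
  obtain ⟨p1, p2, a1, a2⟩ := hc
  have b1 := int_bound t ht x.1 p1 a1
  have b2 := int_bound t ht x.2 p2 a2
  set c1 : ℝ := (t.choose (((t:ℤ)+x.1)/2).toNat : ℝ)
  set c2 : ℝ := (t.choose (((t:ℤ)+x.2)/2).toNat : ℝ)
  have hc1 : 0 ≤ c1 := Nat.cast_nonneg _
  have hc2 : 0 ≤ c2 := Nat.cast_nonneg _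
  have ht0 : (0:ℝ) < t := by exact_mod_cast ht
  have hr : 0 < (x.1 : ℝ)^2 + (x.2 : ℝ)^2 := by
    have : x.1 ≠ 0 ∨ x.2 ≠ 0 := by
      by_contra! h
      rw [h.1, h.2] at hbig
      norm_num at hbig
    rcases this with h | h
    · have : (x.1:ℝ) ≠ 0 := by exact_mod_cast h
      positivity
    · have : (x.2:ℝ) ≠ 0 := by exact_mod_cast h
      positivity
  set R : ℝ := (x.1 : ℝ)^2 + (x.2 : ℝ)^2 with hR
  set v : ℝ := R/(4*t) with hv
  have hv0 : 0 < v := by positivity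
  have hprod : (c1*c2*t)^2 ≤ (4^t * Real.exp (-v))^2 := by
    calc (c1*c2*t)^2 = (c1^2*t)*(c2^2*t) := by ring
      _ ≤ (4^t * Real.exp (-((x.1:ℝ)^2/(2*t)))) * (4^t * Real.exp (-((x.2:ℝ)^2/(2*t)))) := by
          gcongr
      _ = (4^t)^2 * Real.exp (-((x.1:ℝ)^2/(2*t)) + -((x.2:ℝ)^2/(2*t))) := by
          rw [Real.exp_add]; ring
      _ = _ := by
          rw [mul_pow, ← Real.exp_nat_mul]
          congr 2
          rw [hv, hR]
          push_cast
          field_simp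
          ring
  have hprod' : c1*c2*t ≤ 4^t * Real.exp (-v) :=
    le_of_sq_le_sq hprod (by positivity)
  have hexp : v^2 ≤ Real.exp v := by
    have h := Real.sum_le_exp_of_nonneg hv0.le 4
    simp only [Finset.sum_range_succ, Finset.sum_range_zero, Nat.factorial] at h
    norm_num at h
    nlinarith [mul_nonneg hv0.le (sq_nonneg (v-2)), sq_nonneg (v-2)]
  have hexp' : v^2 * Real.exp (-v) ≤ 1 := by
    rw [Real.exp_neg, ← div_eq_mul_inv, div_le_one (Real.exp_pos _)]
    exact hexp
  rw [div_le_div_iff₀ ht0 (by positivity)]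
  have hRv : R = 4*t*v := by rw [hv]; field_simp
  rw [zpow_neg, zpow_natCast, hRv]
  calc ((4:ℝ)^t)⁻¹ * c1 * c2 * (4*t*v)^2 = 16*t*v^2*((4:ℝ)^t)⁻¹ * (c1*c2*t) := by ring
    _ ≤ 16*t*v^2*((4:ℝ)^t)⁻¹ * (4^t * Real.exp (-v)) := by gcongr
    _ = 16*t*(v^2*Real.exp (-v)) := by field_simp
    _ ≤ 16*t*1 := by gcongr
    _ ≤ 17*t := by linarith
end

section
/- For every x ∈ ℤ² with x₁ ≡ x₂ (mod 2) and ‖x‖_∞ ≥ 88, and every integer t ≥ 1, one has H(x,t)/t² ≤ 217/(x₁² + x₂²)³. -/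
open Finset

theorem central_aux (n : ℕ) : (2*(n:ℝ)+1) * ((Nat.choose (2*n) n : ℕ) : ℝ)^2 ≤ 16^n := by
  induction n with
  | zero => simp
  | succ n ih =>
    have h := Nat.succ_mul_centralBinom_succ n
    simp only [Nat.centralBinom] at h
    have h' : ((n:ℝ)+1) * ((Nat.choose (2*(n+1)) (n+1) : ℕ) : ℝ)
        = 2 * (2*n+1) * ((Nat.choose (2*n) n : ℕ) : ℝ) := by exact_mod_cast h
    generalize ((Nat.choose (2*(n+1)) (n+1) : ℕ) : ℝ) = B at *
    generalize ((Nat.choose (2*n) n : ℕ) : ℝ) = A at *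
    have hn : (0:ℝ) ≤ n := Nat.cast_nonneg n
    have e : ((n:ℝ)+1)^2 * ((2*((n+1:ℕ):ℝ)+1) * B^2)
        = 4*(2*n+3)*(2*n+1)*((2*n+1)*A^2) := by
      push_cast
      linear_combination (2*(n:ℝ)+3) * (((n:ℝ)+1)*B + 2 * (2*n+1) * A) * h'
    have hp : (0:ℝ) < ((n:ℝ)+1)^2 := by positivity
    refine le_of_mul_le_mul_left ?_ hp
    rw [e, pow_succ (16:ℝ) n]
    have hq : (0:ℝ) ≤ 16^n := by positivity
    calc 4*(2*(n:ℝ)+3)*(2*n+1)*((2*n+1)*A^2) ≤ 4*(2*(n:ℝ)+3)*(2*n+1)*16^n := by gcongr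
      _ ≤ _ := by nlinarith

theorem step_aux (d a : ℕ) : (((2*a+d : ℕ) : ℝ)) * ((Nat.choose (2*a+d) (a+d) : ℕ) : ℝ)^2
    ≤ 4^(2*a+d) * Real.exp (-((d:ℝ)^2/(2*((2*a+d : ℕ):ℝ)))) := by
  induction d using Nat.strong_induction_on generalizing a with
  | _ d ih =>
  match d, ih with
  | 0, _ =>
    have := central_aux a
    simp only [add_zero]
    have e : (4:ℝ)^(2*a) = 16^a := by rw [pow_mul]; norm_num
    rw [e]
    simp
    nlinarith [sq_nonneg (((Nat.choose (2*a) a : ℕ) : ℝ))]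
  | 1, _ =>
    have h := central_aux (a+1)
    have hc : Nat.choose (2*(a+1)) (a+1) = 2 * Nat.choose (2*a+1) (a+1) := by
      have h1 : 2*(a+1) = (2*a+1)+1 := by ring
      rw [h1, Nat.choose_succ_succ', ← Nat.choose_symm_half a]; ring
    rw [hc] at h
    push_cast at h ⊢
    generalize ((Nat.choose (2*a+1) (a+1) : ℕ) : ℝ) = A at *
    have e : (4:ℝ)^(2*a+1) = 4*16^a := by rw [pow_succ, pow_mul]; norm_num; ring
    have ha : (0:ℝ) ≤ a := Nat.cast_nonneg a
    have hE := Real.add_one_le_exp (-((1:ℝ)^2/(2*(2*(a:ℝ)+1))))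
    have h2 : (2*(a:ℝ)+1)/(2*a+3) ≤ Real.exp (-((1:ℝ)^2/(2*(2*(a:ℝ)+1)))) := by
      refine le_trans ?_ hE
      rw [div_le_iff₀ (by positivity)]
      have : (-((1:ℝ)^2/(2*(2*(a:ℝ)+1))) + 1) = (4*a+1)/(4*a+2) := by
        field_simp; ring
      rw [this, div_mul_eq_mul_div, le_div_iff₀ (by positivity)]
      nlinarith
    rw [e]
    refine le_trans ?_ (mul_le_mul_of_nonneg_left h2 (by positivity))
    rw [mul_div_assoc', le_div_iff₀ (by positivity)]
    rw [pow_succ (16:ℝ) a] at h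
    have h3 : (2*(a:ℝ)+3) * A^2 ≤ 4*16^a := by nlinarith
    nlinarith
  | d+2, ih =>
    have h := ih d (by omega) (a+1)
    have et : 2*(a+1)+d = 2*a+(d+2) := by ring
    have hr := Nat.choose_succ_right_eq (2*a+(d+2)) (a+d+1)
    have e1 : 2*a+(d+2)-(a+d+1) = a+1 := by omega
    rw [e1] at hr
    have e2 : a+1+d = a+d+1 := by ring
    have e3 : a+(d+2) = a+d+1+1 := by ring
    rw [et, e2] at h
    rw [e3]
    have hr' : ((Nat.choose (2*a+(d+2)) (a+d+1+1) : ℕ):ℝ) * ((a:ℝ)+d+2)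
      = ((Nat.choose (2*a+(d+2)) (a+d+1) : ℕ):ℝ) * ((a:ℝ)+1) := by
      have : ((a:ℝ)+d+2) = ((a+d+1+1:ℕ):ℝ) := by push_cast; ring
      rw [this]; exact_mod_cast hr
    generalize ((Nat.choose (2*a+(d+2)) (a+d+1+1) : ℕ):ℝ) = B at *
    generalize ((Nat.choose (2*a+(d+2)) (a+d+1) : ℕ):ℝ) = A at *
    have ha : (0:ℝ) ≤ a := Nat.cast_nonneg a
    have hd : (0:ℝ) ≤ d := Nat.cast_nonneg d
    have hT : ((2*a+(d+2) : ℕ) : ℝ) = 2*a+d+2 := by push_cast; ring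
    rw [hT] at h ⊢
    set T : ℝ := 2*a+d+2 with hTd
    have hT0 : 0 < T := by positivity
    have hB : B = A * (((a:ℝ)+1)/(a+d+2)) := by
      rw [mul_div_assoc', eq_div_iff (by positivity)]; exact hr'
    have hq : ((a:ℝ)+1)/(a+d+2) ≤ Real.exp (-(((d:ℝ)+1)/T)) := by
      refine le_trans ?_ (Real.add_one_le_exp _)
      have : -(((d:ℝ)+1)/T) + 1 = (2*a+1)/T := by field_simp; rw [hTd]; ring
      rw [this, div_le_div_iff₀ (by positivity) hT0, hTd]
      nlinarith [mul_nonneg ha hd]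
    have hq2 : (((a:ℝ)+1)/(a+d+2))^2 ≤ Real.exp (-(((d:ℝ)+1)/T))^2 := by
      gcongr
    have hE : Real.exp (-(((d+2:ℕ):ℝ)^2/(2*T)))
        = Real.exp (-((d:ℝ)^2/(2*T))) * Real.exp (-(((d:ℝ)+1)/T))^2 := by
      rw [← Real.exp_nat_mul, ← Real.exp_add]
      congr 1
      push_cast
      field_simp
      ring
    rw [hE, hB]
    calc T * (A * (((a:ℝ)+1)/(a+d+2)))^2 = (T * A^2) * (((a:ℝ)+1)/(a+d+2))^2 := by ring
      _ ≤ (4 ^ (2*a+(d+2)) * Real.exp (-((d:ℝ)^2/(2*T)))) * Real.exp (-(((d:ℝ)+1)/T))^2 :=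
        mul_le_mul h hq2 (by positivity) (by positivity)
      _ = _ := by ring

theorem choose_aux (t : ℕ) (x : ℤ) (h1 : x % 2 = (t:ℤ) % 2) (h2 : |x| ≤ (t:ℤ)) :
    (t:ℝ) * ((Nat.choose t (((t : ℤ) + x) / 2).toNat : ℕ) : ℝ)^2
      ≤ 4^t * Real.exp (-((x:ℝ)^2/(2*(t:ℝ)))) := by
  obtain ⟨d, hd⟩ : ∃ d : ℕ, (d:ℤ) = |x| := ⟨x.natAbs, by simp⟩
  obtain ⟨a, ha⟩ : ∃ a : ℕ, t = 2*a+d := ⟨(t-d)/2, by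
    rcases abs_cases x with h | h <;> omega⟩
  have hx2 : (x:ℝ)^2 = (d:ℝ)^2 := by
    have : x^2 = (d:ℤ)^2 := by rw [hd, sq_abs]
    exact_mod_cast this
  have hch : Nat.choose t (((t : ℤ) + x) / 2).toNat = Nat.choose (2*a+d) (a+d) := by
    rcases abs_cases x with h | h
    · have : (((t : ℤ) + x) / 2).toNat = a + d := by omega
      rw [this, ha]
    · have : (((t : ℤ) + x) / 2).toNat = a := by omega
      rw [this, ha]
      exact Nat.choose_symm_of_eq_add (by ring)
  rw [hch, hx2, ha]
  exact step_aux d a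

/-- For `‖x‖_∞ ≥ 88` and all `t ≥ 1`: `H(x,t)/t² ≤ 217/(x₁²+x₂²)³`. -/
theorem H_div_t_sq_le (x : Vtx) (hx : inV x) (hbig : 88 ≤ max |x.1| |x.2|)
    (t : ℕ) (ht : 1 ≤ t) :
    H x t / (t : ℝ)^2 ≤ 217 / ((x.1 : ℝ)^2 + (x.2 : ℝ)^2)^3 := by
  obtain ⟨x1, x2⟩ := x
  simp only at hbig ⊢
  have hR : (0:ℝ) < (x1:ℝ)^2 + (x2:ℝ)^2 := by
    rcases le_max_iff.mp hbig with h | h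
    · have : x1 ≠ 0 := by rintro rfl; simp at h
      have : (x1:ℝ) ≠ 0 := by exact_mod_cast this
      positivity
    · have : x2 ≠ 0 := by rintro rfl; simp at h
      have : (x2:ℝ) ≠ 0 := by exact_mod_cast this
      positivity
  unfold H
  split_ifs with hc
  swap
  · rw [zero_div]; positivity
  obtain ⟨p1, p2, q1, q2⟩ := hc
  have b1 := choose_aux t x1 p1 q1
  have b2 := choose_aux t x2 p2 q2
  simp only
  generalize ((Nat.choose t (((t : ℤ) + x1) / 2).toNat : ℕ) : ℝ) = A at *
  generalize ((Nat.choose t (((t : ℤ) + x2) / 2).toNat : ℕ) : ℝ) = B at *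
  have hT0 : (0:ℝ) < t := by exact_mod_cast ht
  generalize hR' : (x1:ℝ)^2 + (x2:ℝ)^2 = R at *
  set u : ℝ := R/(4*t) with hu
  have hu0 : 0 < u := by positivity
  have hE : Real.exp (-((x1:ℝ)^2/(2*(t:ℝ)))) * Real.exp (-((x2:ℝ)^2/(2*(t:ℝ))))
      = Real.exp (-u)^2 := by
    rw [← Real.exp_nat_mul, ← Real.exp_add, hu, ← hR']
    congr 1
    push_cast
    field_simp
    ring
  have hAB : (t:ℝ) * (A*B) ≤ 4^t * Real.exp (-u) := by
    refine abs_le_of_sq_le_sq' ?_ (by positivity) |>.2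
    calc ((t:ℝ) * (A*B))^2 = (t * A^2) * (t * B^2) := by ring
      _ ≤ (4^t * Real.exp (-((x1:ℝ)^2/(2*(t:ℝ))))) * (4^t * Real.exp (-((x2:ℝ)^2/(2*(t:ℝ))))) := by
        gcongr
      _ = (4^t)^2 * (Real.exp (-((x1:ℝ)^2/(2*(t:ℝ)))) * Real.exp (-((x2:ℝ)^2/(2*(t:ℝ))))) := by ring
      _ = _ := by rw [hE]; ring
  have hexp : Real.exp (-u) * (8*u^3) ≤ 27 := by
    have h1 : u/3 ≤ Real.exp (u/3 - 1) := by linarith [Real.add_one_le_exp (u/3-1)]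
    have h2 : (2:ℝ) ≤ Real.exp 1 := by linarith [Real.add_one_le_exp (1:ℝ)]
    have h3 : 2*(u/3) ≤ Real.exp (u/3) := by
      have : Real.exp (u/3) = Real.exp 1 * Real.exp (u/3-1) := by
        rw [← Real.exp_add]; congr 1; ring
      rw [this]; gcongr
    have h4 : (2*(u/3))^3 ≤ Real.exp u := by
      have : Real.exp u = Real.exp (u/3)^3 := by
        rw [← Real.exp_nat_mul]; congr 1; push_cast; ring
      rw [this]; gcongr
    rw [Real.exp_neg, inv_mul_le_iff₀ (Real.exp_pos u)]
    linarith
  have hRu : R = 4*t*u := by rw [hu]; field_simp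
  rw [zpow_neg, zpow_natCast, div_le_div_iff₀ (by positivity) (by positivity), hRu]
  have hk : ((4:ℝ)^t)⁻¹ * ((t:ℝ) * (A*B)) ≤ Real.exp (-u) := by
    rw [inv_mul_le_iff₀ (by positivity)]; exact hAB
  calc ((4:ℝ)^t)⁻¹ * A * B * (4*t*u)^3
      = (((4:ℝ)^t)⁻¹ * ((t:ℝ) * (A*B))) * (64*t^2*u^3) := by ring
    _ ≤ Real.exp (-u) * (64*t^2*u^3) := by gcongr
    _ = (Real.exp (-u) * (8*u^3)) * (8*t^2) := by ring
    _ ≤ 27 * (8*t^2) := by gcongr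
    _ ≤ 217 * (t:ℝ)^2 := by nlinarith [sq_nonneg (t:ℝ)]
end

section
/- For every integer x₁ ≥ 1, the sum ∑_{x₂=0}^{∞} 1/(x₁² + x₂²)² converges and satisfies ∑_{x₂=0}^{∞} 1/(x₁² + x₂²)² ≤ 7/(3·x₁³). -/
theorem aux_step (a n : ℝ) (ha : 1 ≤ a) (hn : 0 ≤ n) :
    1 / (a^2 + (n+1)^2)^2 ≤ 4 / (3 * (a+n)^3) - 4 / (3 * (a+(n+1))^3) := by
  have h1 : 1 / (a^2 + (n+1)^2)^2 ≤ 4 / (a+n+1)^4 := by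
    rw [div_le_div_iff₀ (by positivity) (by positivity)]
    have h2 : (a+n+1)^2 ≤ 2 * (a^2 + (n+1)^2) := by nlinarith [sq_nonneg (a-(n+1))]
    have h3 := pow_le_pow_left₀ (by positivity) h2 2
    nlinarith [h3]
  refine h1.trans ?_
  rw [show a + (n+1) = (a+n)+1 by ring]
  generalize hs : a + n = s
  have hs1 : 0 < s := by linarith
  have h4 : 4 / (3 * s^3) - 4 / (3 * (s+1)^3) - 4 / (s+1)^4
      = 4 * (6*s^2+4*s+1) / (3 * s^3 * (s+1)^4) := by
    field_simp
    ring
  have h5 : 0 ≤ 4 * (6*s^2+4*s+1) / (3 * s^3 * (s+1)^4) := by positivity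
  linarith

theorem aux_partial (a : ℝ) (ha : 1 ≤ a) (n : ℕ) :
    ∑ i ∈ Finset.range (n+1), 1 / (a^2 + (i:ℝ)^2)^2
      ≤ 7 / (3 * a^3) - 4 / (3 * (a+n)^3) := by
  induction n with
  | zero =>
    have h0 : 7 / (3 * a^3) - 4 / (3 * a^3) = 1 / a^3 := by
      field_simp
      norm_num
    simp only [zero_add, Finset.sum_range_one, Nat.cast_zero, add_zero]
    rw [h0]
    apply one_div_le_one_div_of_le (by positivity)
    have : a^3 * 1 ≤ a^3 * a := mul_le_mul_of_nonneg_left ha (by positivity)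
    nlinarith [this]
  | succ k ih =>
    rw [Finset.sum_range_succ]
    have := aux_step a k ha (by positivity)
    push_cast at *
    linarith

/-- For every integer `x₁ ≥ 1`, `∑_{x₂=0}^{∞} 1/(x₁²+x₂²)²` converges and is
at most `7/(3·x₁³)`. -/
theorem sum_inv_sq_sq_le (x₁ : ℤ) (h : 1 ≤ x₁) :
    Summable (fun x₂ : ℕ => 1 / ((x₁ : ℝ)^2 + (x₂ : ℝ)^2)^2) ∧
    ∑' x₂ : ℕ, 1 / ((x₁ : ℝ)^2 + (x₂ : ℝ)^2)^2 ≤ 7 / (3 * (x₁ : ℝ)^3) := by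
  have ha : (1:ℝ) ≤ (x₁:ℝ) := by exact_mod_cast h
  have hnn : ∀ n : ℕ, 0 ≤ 1 / ((x₁ : ℝ)^2 + (n : ℝ)^2)^2 := fun n => by positivity
  have hb : ∀ n : ℕ, ∑ i ∈ Finset.range n, 1 / ((x₁ : ℝ)^2 + (i : ℝ)^2)^2
      ≤ 7 / (3 * (x₁ : ℝ)^3) := by
    intro n
    have h1 := aux_partial _ ha n
    rw [Finset.sum_range_succ] at h1
    have h2 := hnn n
    have h3 : 0 ≤ 4 / (3 * ((x₁:ℝ)+n)^3) := by positivity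
    linarith
  exact ⟨summable_of_sum_range_le hnn hb, Real.tsum_le_of_sum_range_le hnn hb⟩
end
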